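/- For all integers m, s with s ≥ 5 and m > 2s such that the remainder r = m mod 2s satisfies s + 1 ≤ r ≤ 2s − 2, there exists a decentralized linear code of length ℓ = 3·(m − r)/(2·s) + 3 for parameters (m, s) that is both correct and secure. -/

import Mathlib

namespace SDPicod

/-- Side information set of user `i`: the `s` cyclically consecutive message
indices ending at `i`, i.e. `{i - k : k ∈ Finset.range s}`. -/
def sideInfo (m s : ℕ) (i : ZMod m) : Set (ZMod m) :=
  {j | ∃ k ∈ Finset.range s, j = i - (k : ZMod m)}

/-- A decentralized linear code: every row is encodable by some user, i.e.
its support is contained in that user's side information set. -/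
def IsDecentralizedCode (m s : ℕ) {ℓ : ℕ} (G : Fin ℓ → ZMod m → ZMod 2) : Prop :=
  ∀ t : Fin ℓ, ∃ i : ZMod m, Function.support (G t) ⊆ sideInfo m s i

/-- The set of message indices user `i` can decode: indices `j` outside the
side information set such that the standard basis vector `e j` lies in the
`GF(2)`-span of the rows of `G` together with the basis vectors of the
side information set. -/
def decSet (m s : ℕ) {ℓ : ℕ} (G : Fin ℓ → ZMod m → ZMod 2) (i : ZMod m) :
    Set (ZMod m) :=
  {j | j ∉ sideInfo m s i ∧
    Pi.single j (1 : ZMod 2) ∈ Submodule.span (ZMod 2)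
      (Set.range G ∪ {v | ∃ k ∈ sideInfo m s i, v = Pi.single k (1 : ZMod 2)})}

/-- Correctness: every user can decode at least one new message. -/
def Correct (m s : ℕ) {ℓ : ℕ} (G : Fin ℓ → ZMod m → ZMod 2) : Prop :=
  ∀ i : ZMod m, (decSet m s G i).Nonempty

/-- Security: no user can decode more than one new message. -/
def Secure (m s : ℕ) {ℓ : ℕ} (G : Fin ℓ → ZMod m → ZMod 2) : Prop :=
  ∀ i : ZMod m, (decSet m s G i).Subsingleton

end SDPicod

open SDPicod

namespace SDPicod

/-- User `i`, represented by an integer of `[s - 3, m + (s - 3))`, has message `j < m` as side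
information. -/
def Known (m s i j : ℕ) : Prop := (j ≤ i ∧ i < j + s) ∨ j + m ≤ i ∨ i + m < j + s

lemma mem_sideInfo_iff {m s i : ℕ} [NeZero m] (hm : 2 * s < m) (hi : s - 3 ≤ i)
    (hi' : i < m + (s - 3)) (j : ZMod m) :
    j ∈ sideInfo m s (i : ZMod m) ↔ Known m s i j.val := by
  have hj := ZMod.val_lt j
  have key : ∀ k : ℕ, j = (i : ZMod m) - (k : ZMod m) ↔ ((m : ℤ) ∣ (i : ℤ) - (j.val + k : ℕ)) := by
    intro k
    rw [eq_sub_iff_add_eq, ← ZMod.intCast_eq_intCast_iff_dvd_sub]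
    push_cast
    rw [ZMod.natCast_zmod_val]
  simp only [sideInfo, Set.mem_ofPred_eq, Finset.mem_range, key, Known]
  constructor
  · rintro ⟨k, hk, d, hd⟩
    have hu : (m : ℤ) * d < m * 2 := by omega
    have hl : (m : ℤ) * (-2) < m * d := by omega
    have h1 : d < 2 := lt_of_mul_lt_mul_left hu (by omega)
    have h2 : -2 < d := lt_of_mul_lt_mul_left hl (by omega)
    have h3 : d = -1 ∨ d = 0 ∨ d = 1 := by omega
    rcases h3 with rfl | rfl | rfl <;> omega
  · rintro (h | h | h)
    · exact ⟨i - j.val, by omega, 0, by omega⟩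
    · exact ⟨i - m - j.val, by omega, 1, by omega⟩
    · exact ⟨i + m - j.val, by omega, -1, by omega⟩

open Classical in
/-- Coordinate `j` of the combination with coefficients `w` of the indicators of the sets `R t`. -/
noncomputable def comb {ι : Type} [Fintype ι] (R : ι → ℕ → Prop) (w : ι → ZMod 2) (j : ℕ) : ZMod 2 :=
  ∑ t, w t * if R t j then 1 else 0

lemma exists_comb_of_mem_decSet {m s ℓ : ℕ} {G : Fin ℓ → ZMod m → ZMod 2} {i j : ZMod m}
    (h : j ∈ decSet m s G i) :
    ∃ w : Fin ℓ → ZMod 2, ∑ t, w t * G t j = 1 ∧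
      ∀ k, k ∉ sideInfo m s i → k ≠ j → ∑ t, w t * G t k = 0 := by
  obtain ⟨hj, h⟩ := h
  rw [Submodule.span_union, Submodule.mem_sup] at h
  obtain ⟨y, hy, z, hz, hyz⟩ := h
  obtain ⟨w, rfl⟩ := (Submodule.mem_span_range_iff_exists_fun _).1 hy
  have hz' : ∀ k, k ∉ sideInfo m s i → z k = 0 := by
    intro k hk
    clear hyz
    induction hz using Submodule.span_induction with
    | mem x hx =>
      obtain ⟨l, hl, rfl⟩ := hx
      exact Pi.single_eq_of_ne (by rintro rfl; exact hk hl) _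
    | zero => rfl
    | add x y _ _ hx hy => simp [hx, hy]
    | smul a x _ hx => simp [hx]
  have ev : ∀ k, k ∉ sideInfo m s i →
      ∑ t, w t * G t k = (Pi.single j (1 : ZMod 2) : ZMod m → ZMod 2) k := by
    intro k hk
    rw [← hyz]
    simp [hz' k hk, Finset.sum_apply]
  refine ⟨w, ?_, fun k hk hkj => ?_⟩
  · rw [ev j hj, Pi.single_eq_same]
  · rw [ev k hk, Pi.single_eq_of_ne hkj]

lemma mem_decSet_of_row {m s ℓ : ℕ} [NeZero m] {G : Fin ℓ → ZMod m → ZMod 2} {i j : ZMod m}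
    (hj : j ∉ sideInfo m s i) (t : Fin ℓ) (htj : G t j = 1)
    (ht : ∀ k, k ∉ sideInfo m s i → k ≠ j → G t k = 0) : j ∈ decSet m s G i := by
  refine ⟨hj, ?_⟩
  set V := Submodule.span (ZMod 2)
    (Set.range G ∪ {v | ∃ k ∈ sideInfo m s i, v = Pi.single k (1 : ZMod 2)})
  have hsum : G t = ∑ k, G t k • (Pi.single k (1 : ZMod 2) : ZMod m → ZMod 2) :=
    pi_eq_sum_univ' (G t)
  rw [← Finset.add_sum_erase _ _ (Finset.mem_univ j), htj, one_smul] at hsum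
  rw [← sub_eq_iff_eq_add] at hsum
  rw [← hsum]
  refine V.sub_mem (Submodule.subset_span (Or.inl ⟨t, rfl⟩)) (V.sum_mem fun k hk => ?_)
  by_cases hki : k ∈ sideInfo m s i
  · exact V.smul_mem _ (Submodule.subset_span (Or.inr ⟨k, hki, rfl⟩))
  · rw [ht k hki (Finset.ne_of_mem_erase hk), zero_smul]
    exact V.zero_mem

/-- A family of subsets of `{0, …, m - 1}` yields a correct and secure decentralized code as soon as
each set fits in a window, and each user misses exactly one element of one of the sets, and cannot
decode any other element from a combination of the sets. -/
theorem exists_code_of_sets {m s ℓ : ℕ} (hm : 2 * s < m) {ι : Type} [Fintype ι]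
    (hι : Fintype.card ι = ℓ) (R : ι → ℕ → Prop)
    (hw : ∀ t, ∃ u < m, ∀ j, R t j → j ≤ u ∧ u < j + s)
    (hdec : ∀ i, s - 3 ≤ i → i < m + (s - 3) → ∃ k < m, ¬ Known m s i k ∧
      (∃ t, R t k ∧ ∀ j, R t j → j ≠ k → Known m s i j) ∧
      ∀ (w : ι → ZMod 2) (k' : ℕ), k' < m → ¬ Known m s i k' → comb R w k' ≠ 0 →
        (∀ j < m, ¬ Known m s i j → j ≠ k' → comb R w j = 0) → k' = k) :
    ∃ G : Fin ℓ → ZMod m → ZMod 2,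
      IsDecentralizedCode m s G ∧ Correct m s G ∧ Secure m s G := by
  classical
  have : NeZero m := ⟨by omega⟩
  let e := Fintype.equivFinOfCardEq hι
  let G : Fin ℓ → ZMod m → ZMod 2 := fun t j => if R (e.symm t) j.val then 1 else 0
  have hcomb : ∀ (w : Fin ℓ → ZMod 2) (j : ZMod m),
      ∑ t, w t * G t j = comb R (w ∘ e) j.val := by
    intro w j
    rw [comb, ← e.sum_comp]
    simp [G]
  have rep : ∀ i : ZMod m, ∃ n : ℕ, s - 3 ≤ n ∧ n < m + (s - 3) ∧ i = n := by
    intro i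
    have hi := ZMod.val_lt i
    by_cases h : s - 3 ≤ i.val
    · exact ⟨i.val, h, by omega, by simp⟩
    · exact ⟨i.val + m, by omega, by omega, by simp⟩
  refine ⟨G, fun t => ?_, fun i => ?_, fun i => ?_⟩
  · obtain ⟨u, hu, h⟩ := hw (e.symm t)
    refine ⟨(u : ZMod m), fun j hj => ?_⟩
    have hR : R (e.symm t) j.val := by
      by_contra hR
      exact hj (if_neg hR)
    obtain ⟨h1, h2⟩ := h _ hR
    refine ⟨u - j.val, Finset.mem_range.2 (by omega), ?_⟩
    rw [Nat.cast_sub h1, ZMod.natCast_zmod_val]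
    ring
  · obtain ⟨n, hn, hn', rfl⟩ := rep i
    obtain ⟨k, hk, hkn, ⟨t, htk, ht⟩, -⟩ := hdec n hn hn'
    refine ⟨(k : ZMod m), mem_decSet_of_row (t := e t) ?_ ?_ ?_⟩
    · rwa [mem_sideInfo_iff hm hn hn', ZMod.val_cast_of_lt hk]
    · simp [G, ZMod.val_cast_of_lt hk, htk]
    · intro j hj hjk
      rw [mem_sideInfo_iff hm hn hn'] at hj
      have : ¬ R t j.val := fun h => hj (ht _ h fun h' => hjk (by rw [← h']; simp))
      simp [G, this]
  · obtain ⟨n, hn, hn', rfl⟩ := rep i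
    obtain ⟨k, hk, hkn, -, hu⟩ := hdec n hn hn'
    have main : ∀ j ∈ decSet m s G (n : ZMod m), j.val = k := by
      intro j hj
      obtain ⟨w, h1, h2⟩ := exists_comb_of_mem_decSet hj
      refine hu (w ∘ e) _ (ZMod.val_lt j) ?_ ?_ ?_
      · rw [← mem_sideInfo_iff hm hn hn']
        exact hj.1
      · rw [← hcomb, h1]
        exact one_ne_zero
      · intro l hl hln hlj
        have := h2 (l : ZMod m) (by rwa [mem_sideInfo_iff hm hn hn', ZMod.val_cast_of_lt hl])
          (fun h => hlj (by rw [← h, ZMod.val_cast_of_lt hl]))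
        rwa [hcomb, ZMod.val_cast_of_lt hl] at this
    intro j hj j' hj'
    exact ZMod.val_injective m ((main j hj).trans (main j' hj').symm)

/-- Smaller offsets of the three two-element rows of a regular block. -/
def lo (s : ℕ) : Fin 3 → ℕ := ![0, 2, s + 1]

/-- Larger offsets of the three two-element rows of a regular block. -/
def hi (s : ℕ) : Fin 3 → ℕ := ![1, s, s + 2]

/-- First index of the regular block number `b`; the regular blocks have length `2 * s` and are
preceded by an exceptional block of length `L` starting at `s - 3`. -/
def base (s L b : ℕ) : ℕ := s - 3 + L + 2 * s * b

/-- Supports of the rows: two-element rows for the `q` regular blocks, and three exceptional rows. -/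
def blockRows (s L q : ℕ) (S : Fin 3 → ℕ → Prop) : (Fin q × Fin 3) ⊕ Fin 3 → ℕ → Prop :=
  Sum.elim (fun x j => j = base s L x.1 + lo s x.2 ∨ j = base s L x.1 + hi s x.2) S

/-- User `i` decodes `k` from a combination of the exceptional rows. -/
def SpecDec (m s : ℕ) (S : Fin 3 → ℕ → Prop) (i k : ℕ) : Prop :=
  ¬ Known m s i k ∧ ∃ a : Fin 3 → ZMod 2, comb S a k ≠ 0 ∧
    ∀ j, ¬ Known m s i j → j ≠ k → comb S a j = 0

/-- User `i` decodes `k` from a row of a regular block. -/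
def RegDec (m s L q i k : ℕ) : Prop :=
  ¬ Known m s i k ∧ ∃ b < q, ∃ x : Fin 3,
    (k = base s L b + lo s x ∧ Known m s i (base s L b + hi s x)) ∨
    (k = base s L b + hi s x ∧ Known m s i (base s L b + lo s x))

lemma base_cases (s L b b' : ℕ) :
    (b = b' ∧ base s L b = base s L b') ∨ (b + 1 = b' ∧ base s L b + 2 * s = base s L b') ∨
    (b' + 1 = b ∧ base s L b' + 2 * s = base s L b) ∨
    (b + 2 ≤ b' ∧ base s L b + 4 * s ≤ base s L b') ∨
    (b' + 2 ≤ b ∧ base s L b' + 4 * s ≤ base s L b) := by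
  unfold base
  rcases lt_trichotomy b b' with h | rfl | h
  · obtain ⟨d, rfl⟩ := Nat.exists_eq_add_of_lt h
    rcases d with _ | d
    · right; left; constructor <;> ring
    · right; right; right; left
      refine ⟨by omega, ?_⟩
      nlinarith [Nat.zero_le (s * d)]
  · simp
  · obtain ⟨d, rfl⟩ := Nat.exists_eq_add_of_lt h
    rcases d with _ | d
    · right; right; left; constructor <;> ring
    · right; right; right; right
      refine ⟨by omega, ?_⟩
      nlinarith [Nat.zero_le (s * d)]

lemma base_bounds {m s L q b : ℕ} (hm : m = 2 * s * q + L) (hb : b < q) :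
    s - 3 + L ≤ base s L b ∧ base s L b + 2 * s ≤ m + (s - 3) := by
  have : 2 * s * (b + 1) ≤ 2 * s * q := Nat.mul_le_mul_left _ hb
  unfold base
  constructor
  · omega
  · rw [mul_add] at this
    omega

lemma lo_hi_cases (s : ℕ) (x : Fin 3) :
    (x = 0 ∧ lo s x = 0 ∧ hi s x = 1) ∨ (x = 1 ∧ lo s x = 2 ∧ hi s x = s) ∨
    (x = 2 ∧ lo s x = s + 1 ∧ hi s x = s + 2) := by
  fin_cases x <;> simp [lo, hi]

lemma comb_blockRows_of_lt {s L q j : ℕ} {S : Fin 3 → ℕ → Prop} (hj : j < s - 3 + L)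
    (w : (Fin q × Fin 3) ⊕ Fin 3 → ZMod 2) :
    comb (blockRows s L q S) w j = comb S (fun t => w (Sum.inr t)) j := by
  have h : ∀ x : Fin q × Fin 3, ¬ blockRows s L q S (Sum.inl x) j := by
    intro x hx
    simp only [blockRows, Sum.elim_inl, base] at hx
    omega
  simp only [comb, Fintype.sum_sum_type, h]
  simp only [if_false, mul_zero, Finset.sum_const_zero, zero_add]
  rfl

lemma comb_blockRows_of_mem {s L q j : ℕ} {S : Fin 3 → ℕ → Prop} (hs : 5 ≤ s)
    (hS : ∀ t j, S t j → j < s - 3 + L)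
    (w : (Fin q × Fin 3) ⊕ Fin 3 → ZMod 2) (x : Fin q × Fin 3)
    (hj : blockRows s L q S (Sum.inl x) j) :
    comb (blockRows s L q S) w j = w (Sum.inl x) := by
  rw [comb, Finset.sum_eq_single (Sum.inl x)]
  · simp [hj]
  · rintro (y | t) - hy
    · rw [if_neg, mul_zero]
      intro hyj
      apply hy
      simp only [blockRows, Sum.elim_inl] at hj hyj
      obtain ⟨⟨b, hb⟩, u⟩ := x
      obtain ⟨⟨b', hb'⟩, u'⟩ := y
      simp only at hj hyj
      have h1 := base_cases s L b b'
      have h2 : b = b' ∧ u = u' := by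
        rcases lo_hi_cases s u with ⟨hu, e1, e2⟩ | ⟨hu, e1, e2⟩ | ⟨hu, e1, e2⟩ <;>
        rcases lo_hi_cases s u' with ⟨hu', e1', e2'⟩ | ⟨hu', e1', e2'⟩ | ⟨hu', e1', e2'⟩ <;>
        rw [e1, e2] at hj <;> rw [e1', e2'] at hyj <;> simp only [hu, hu'] <;>
        first
          | (refine ⟨?_, trivial⟩; omega)
          | (exfalso; omega)
      simp [h2.1, h2.2]
    · rw [if_neg, mul_zero]
      intro hyj
      have h1 := hS t j hyj
      simp only [blockRows, Sum.elim_inl, base] at hj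
      omega
  · simp

lemma regDec_or_specDec {m s L q i k : ℕ} {S : Fin 3 → ℕ → Prop} (hs : 5 ≤ s)
    (hq : 0 < q) (hm : m = 2 * s * q + L) (hS : ∀ t j, S t j → j < s - 3 + L)
    {w : (Fin q × Fin 3) ⊕ Fin 3 → ZMod 2} (hk : ¬ Known m s i k)
    (hwk : comb (blockRows s L q S) w k ≠ 0)
    (hw : ∀ j < m, ¬ Known m s i j → j ≠ k → comb (blockRows s L q S) w j = 0) :
    RegDec m s L q i k ∨ SpecDec m s S i k := by
  by_cases hkL : k < s - 3 + L
  · right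
    refine ⟨hk, fun t => w (Sum.inr t), by rwa [← comb_blockRows_of_lt hkL], fun j hj hjk => ?_⟩
    by_cases hjL : j < s - 3 + L
    · rw [← comb_blockRows_of_lt hjL]
      have := Nat.le_mul_of_pos_right (2 * s) hq
      exact hw j (by omega) hj hjk
    · have : ∀ t, ¬ S t j := fun t h => hjL (hS t j h)
      simp [comb, this]
  · left
    refine ⟨hk, ?_⟩
    have hex : ∃ x : Fin q × Fin 3, blockRows s L q S (Sum.inl x) k := by
      by_contra! hx
      have h2 : ∀ t, ¬ S t k := fun t h => hkL (hS t k h)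
      apply hwk
      simp only [comb, Fintype.sum_sum_type, hx]
      simp [blockRows, h2]
    obtain ⟨x, hx⟩ := hex
    rw [comb_blockRows_of_mem hs hS w x hx] at hwk
    have other : ∀ j, j ≠ k → blockRows s L q S (Sum.inl x) j → Known m s i j := by
      intro j hjk hj
      by_contra hjn
      apply hwk
      rw [← comb_blockRows_of_mem hs hS w x hj]
      refine hw j ?_ hjn hjk
      have := base_bounds hm x.1.2
      have := lo_hi_cases s x.2
      simp only [blockRows, Sum.elim_inl] at hj
      omega
    have hlh := lo_hi_cases s x.2
    refine ⟨x.1, x.1.2, x.2, ?_⟩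
    rcases hx with hx | hx
    · exact Or.inl ⟨hx, other _ (by omega) (Or.inr rfl)⟩
    · exact Or.inr ⟨hx, other _ (by omega) (Or.inl rfl)⟩

lemma RegDec.cases {m s L q b o k : ℕ} (hs : 5 ≤ s) (hL : s + 1 ≤ L) (hm : m = 2 * s * q + L)
    (hb : b < q) (ho : o < 2 * s) (h : RegDec m s L q (base s L b + o) k) :
    (o = 0 ∧ k = base s L b + 1) ∨
    (o = 1 ∧ 0 < b ∧ k + 2 * s = base s L b + (s + 1)) ∨
    (2 ≤ o ∧ o < s ∧ k = base s L b + s) ∨ (o = s ∧ k = base s L b) ∨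
    (o = s + 1 ∧ k = base s L b + (s + 2)) ∨ (s + 2 ≤ o ∧ k = base s L b + 2) := by
  obtain ⟨hk, b', hb', x, h⟩ := h
  have h1 := base_bounds hm hb
  have h2 := base_bounds hm hb'
  have h3 := base_cases s L b b'
  generalize base s L b = B at *
  generalize base s L b' = B' at *
  have hK : ∀ e ≤ s + 2, Known m s (B + o) (B' + e) ↔ B' + e ≤ B + o ∧ B + o < B' + e + s := by
    intro e he
    unfold Known
    omega
  have hx : lo s x ≤ s + 2 ∧ hi s x ≤ s + 2 := by
    have := lo_hi_cases s x
    omega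
  have h4 : (b = b' ∧ B = B') ∨ (b' + 1 = b ∧ B' + 2 * s = B) := by
    rcases h with ⟨-, h⟩ | ⟨-, h⟩
    · rw [hK _ hx.2] at h
      omega
    · rw [hK _ hx.1] at h
      omega
  clear h1 h2 h3
  have h5 := lo_hi_cases s x
  rcases h with ⟨rfl, h⟩ | ⟨rfl, h⟩
  · rw [hK _ hx.1] at hk
    rw [hK _ hx.2] at h
    clear hK
    rcases h5 with ⟨-, e1, e2⟩ | ⟨-, e1, e2⟩ | ⟨-, e1, e2⟩ <;> rcases h4 with h4 | h4 <;> omega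
  · rw [hK _ hx.2] at hk
    rw [hK _ hx.1] at h
    clear hK
    rcases h5 with ⟨-, e1, e2⟩ | ⟨-, e1, e2⟩ | ⟨-, e1, e2⟩ <;> rcases h4 with h4 | h4 <;> omega

lemma RegDec.eq_of_lt {m s L q o k : ℕ} (hs : 5 ≤ s) (hm : m = 2 * s * q + L)
    (hq : 0 < q) (ho : o < L) (h : RegDec m s L q (s - 3 + o) k) :
    o = 1 ∧ k = base s L (q - 1) + (s + 1) := by
  obtain ⟨hk, b, hb, x, h⟩ := h
  have h1 := base_bounds hm hb
  have h2 : base s L (q - 1) + 2 * s = m + (s - 3) := by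
    obtain ⟨q, rfl⟩ := Nat.exists_eq_add_of_lt hq
    subst hm
    simp [base]
    ring
  have h3 := base_cases s L b (q - 1)
  generalize base s L b = B at *
  generalize base s L (q - 1) = B' at *
  have hK : ∀ e ≤ s + 2, Known m s (s - 3 + o) (B + e) ↔ s - 3 + o + m < B + e + s := by
    intro e he
    unfold Known
    omega
  have hx : lo s x ≤ s + 2 ∧ hi s x ≤ s + 2 := by
    have := lo_hi_cases s x
    omega
  have h4 : B = B' := by
    rcases h with ⟨-, h⟩ | ⟨-, h⟩
    · rw [hK _ hx.2] at h
      omega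
    · rw [hK _ hx.1] at h
      omega
  have h5 := lo_hi_cases s x
  clear h3
  rcases h with ⟨rfl, h⟩ | ⟨rfl, h⟩
  · rw [hK _ hx.1] at hk
    rw [hK _ hx.2] at h
    omega
  · rw [hK _ hx.2] at hk
    rw [hK _ hx.1] at h
    omega

/-- User `i` misses exactly the element `k` of some set of the family `R`. -/
def Served {ι : Type} (m s : ℕ) (R : ι → ℕ → Prop) (i k : ℕ) : Prop :=
  ¬ Known m s i k ∧ ∃ t, R t k ∧ ∀ j, R t j → j ≠ k → Known m s i j

lemma Served.of_spec {m s L q i k : ℕ} {S : Fin 3 → ℕ → Prop} (h : Served m s S i k) :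
    Served m s (blockRows s L q S) i k :=
  ⟨h.1, let ⟨t, ht⟩ := h.2; ⟨Sum.inr t, ht⟩⟩

lemma served_hi {m s L q i b : ℕ} (S : Fin 3 → ℕ → Prop) (hb : b < q) (x : Fin 3)
    (h : ¬ Known m s i (base s L b + hi s x)) (h' : Known m s i (base s L b + lo s x)) :
    Served m s (blockRows s L q S) i (base s L b + hi s x) := by
  refine ⟨h, Sum.inl (⟨b, hb⟩, x), Or.inr rfl, ?_⟩
  rintro j (rfl | rfl) hj
  · exact h'
  · exact absurd rfl hj

lemma served_lo {m s L q i b : ℕ} (S : Fin 3 → ℕ → Prop) (hb : b < q) (x : Fin 3)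
    (h : ¬ Known m s i (base s L b + lo s x)) (h' : Known m s i (base s L b + hi s x)) :
    Served m s (blockRows s L q S) i (base s L b + lo s x) := by
  refine ⟨h, Sum.inl (⟨b, hb⟩, x), Or.inl rfl, ?_⟩
  rintro j (rfl | rfl) hj
  · exact absurd rfl hj
  · exact h'

lemma exists_served_of_regular {m s L q b o : ℕ} (S : Fin 3 → ℕ → Prop) (hs : 5 ≤ s)
    (hL : s + 1 ≤ L) (hm : m = 2 * s * q + L) (hb : b < q) (ho : o < 2 * s)
    (hbo : o = 1 → 0 < b) :
    ∃ k, Served m s (blockRows s L q S) (base s L b + o) k ∧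
      ∀ k', RegDec m s L q (base s L b + o) k' → k' = k := by
  have h1 := base_bounds hm hb
  have h2 := fun k' (h : RegDec m s L q (base s L b + o) k') => h.cases hs hL hm hb ho
  have ho' : o = 0 ∨ o = 1 ∨ (2 ≤ o ∧ o < s) ∨ o = s ∨ o = s + 1 ∨ s + 2 ≤ o := by omega
  rcases ho' with h | h | h | h | h | h
  · refine ⟨_, served_hi S hb 0 ?_ ?_, fun k' hk' => ?_⟩
    · simp only [Known, hi, Matrix.cons_val]; omega
    · simp only [Known, lo, Matrix.cons_val]; omega
    · have := h2 k' hk'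
      simp only [hi, Matrix.cons_val]; omega
  · obtain ⟨b, rfl⟩ : ∃ b', b = b' + 1 := ⟨b - 1, by have := hbo h; omega⟩
    have h3 : base s L (b + 1) = base s L b + 2 * s := by simp only [base]; ring
    rw [h3] at h1 h2 ⊢
    refine ⟨_, served_lo S (b := b) (by omega) 2 ?_ ?_, fun k' hk' => ?_⟩
    · simp only [Known, lo, Matrix.cons_val]; omega
    · simp only [Known, hi, Matrix.cons_val]; omega
    · have := h2 k' hk'
      simp only [lo, Matrix.cons_val]; omega
  · refine ⟨_, served_hi S hb 1 ?_ ?_, fun k' hk' => ?_⟩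
    · simp only [Known, hi, Matrix.cons_val]; omega
    · simp only [Known, lo, Matrix.cons_val]; omega
    · have := h2 k' hk'
      simp only [hi, Matrix.cons_val]; omega
  · refine ⟨_, served_lo S hb 0 ?_ ?_, fun k' hk' => ?_⟩
    · simp only [Known, lo, Matrix.cons_val]; omega
    · simp only [Known, hi, Matrix.cons_val]; omega
    · have := h2 k' hk'
      simp only [lo, Matrix.cons_val]; omega
  · refine ⟨_, served_hi S hb 2 ?_ ?_, fun k' hk' => ?_⟩
    · simp only [Known, hi, Matrix.cons_val]; omega
    · simp only [Known, lo, Matrix.cons_val]; omega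
    · have := h2 k' hk'
      simp only [hi, Matrix.cons_val]; omega
  · refine ⟨_, served_lo S hb 1 ?_ ?_, fun k' hk' => ?_⟩
    · simp only [Known, lo, Matrix.cons_val]; omega
    · simp only [Known, hi, Matrix.cons_val]; omega
    · have := h2 k' hk'
      simp only [lo, Matrix.cons_val]; omega

/-- Three exceptional rows living on the first `s - 3 + L` messages, whose users are all the users
of the exceptional block but the second one, and the second user of the first regular block,
can be completed by regular blocks. -/
theorem exists_code_of_exceptional_rows {m s L q ℓ : ℕ} (hs : 5 ≤ s) (hq : 0 < q)
    (hL : s + 1 ≤ L) (hm : m = 2 * s * q + L) (hℓ : 3 * q + 3 = ℓ) (S : Fin 3 → ℕ → Prop) (p : ℕ)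
    (hSw : ∀ t, ∃ u < s - 3 + L, ∀ j, S t j → j ≤ u ∧ u < j + s)
    (hp : Served m s S (s - 3 + L + 1) p)
    (hspec : ∀ o < L, o ≠ 1 → ∃ k, Served m s S (s - 3 + o) k ∧
      ∀ k', SpecDec m s S (s - 3 + o) k' → k' = k)
    (hone : ∀ k, ¬ SpecDec m s S (s - 3 + 1) k)
    (hreg : ∀ i k, s - 3 + L ≤ i → i < m + (s - 3) → SpecDec m s S i k →
      i = s - 3 + L + 1 ∧ k = p) :
    ∃ G : Fin ℓ → ZMod m → ZMod 2,
      IsDecentralizedCode m s G ∧ Correct m s G ∧ Secure m s G := by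
  have hS : ∀ t j, S t j → j < s - 3 + L := by
    intro t j h
    obtain ⟨u, hu, h'⟩ := hSw t
    have := h' j h
    omega
  have hqs := Nat.le_mul_of_pos_right (2 * s) hq
  have hlt : ∀ t j, blockRows s L q S t j → j < m := by
    rintro (x | t) j hj
    · have := base_bounds hm x.1.2
      have := lo_hi_cases s x.2
      simp only [blockRows, Sum.elim_inl] at hj
      omega
    · have := hS t j hj
      omega
  suffices H : ∀ i, s - 3 ≤ i → i < m + (s - 3) → ∃ k, Served m s (blockRows s L q S) i k ∧
      ∀ k', RegDec m s L q i k' ∨ SpecDec m s S i k' → k' = k by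
    refine exists_code_of_sets (by omega) (ι := (Fin q × Fin 3) ⊕ Fin 3)
      (by simp [← hℓ, mul_comm]) (blockRows s L q S) ?_ ?_
    · rintro (x | t)
      · have := base_bounds hm x.1.2
        have := lo_hi_cases s x.2
        refine ⟨base s L x.1 + hi s x.2, by omega, fun j hj => ?_⟩
        simp only [blockRows, Sum.elim_inl] at hj
        omega
      · obtain ⟨u, hu, h⟩ := hSw t
        exact ⟨u, by omega, h⟩
    · intro i hi hi'
      obtain ⟨k, ⟨hk, t, htk, ht⟩, hu⟩ := H i hi hi'
      exact ⟨k, hlt t k htk, hk, ⟨t, htk, ht⟩, fun w k' _ hk' hwk hw =>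
        hu k' (regDec_or_specDec hs hq hm hS hk' hwk hw)⟩
  intro i hi₀ hi₁
  by_cases hiL : i < s - 3 + L
  · obtain ⟨o, rfl⟩ := Nat.exists_eq_add_of_le hi₀
    by_cases ho : o = 1
    · subst ho
      have h2 : base s L (q - 1) + 2 * s = m + (s - 3) := by
        obtain ⟨q, rfl⟩ := Nat.exists_eq_add_of_lt hq
        subst hm
        simp [base]
        ring
      refine ⟨_, served_lo S (Nat.sub_lt hq one_pos) 2 ?_ ?_, ?_⟩
      · simp only [Known, lo, Matrix.cons_val]; omega
      · simp only [Known, hi, Matrix.cons_val]; omega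
      · rintro k' (h | h)
        · exact (h.eq_of_lt hs hm hq (by omega)).2
        · exact absurd h (hone k')
    · obtain ⟨k, hk, hu⟩ := hspec o (by omega) ho
      refine ⟨k, hk.of_spec, ?_⟩
      rintro k' (h | h)
      · exact absurd (h.eq_of_lt hs hm hq (by omega)).1 ho
      · exact hu k' h
  · have hdm := Nat.div_add_mod (i - (s - 3 + L)) (2 * s)
    have ho := Nat.mod_lt (i - (s - 3 + L)) (show 2 * s > 0 by omega)
    have hb : (i - (s - 3 + L)) / (2 * s) < q := by
      rw [Nat.div_lt_iff_lt_mul (by omega), mul_comm q]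
      omega
    generalize (i - (s - 3 + L)) / (2 * s) = b at *
    generalize (i - (s - 3 + L)) % (2 * s) = o at *
    obtain rfl : i = base s L b + o := by
      unfold base
      omega
    by_cases hbo : o = 1 ∧ b = 0
    · obtain ⟨rfl, rfl⟩ := hbo
      refine ⟨p, Served.of_spec (by simpa [base] using hp), ?_⟩
      rintro k' (h | h)
      · have := h.cases hs hL hm hq (by omega)
        omega
      · exact (hreg _ _ (by omega) hi₁ h).2
    · obtain ⟨k, hk, hu⟩ := exists_served_of_regular S hs hL hm hb ho (by omega)
      refine ⟨k, hk, ?_⟩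
      rintro k' (h | h)
      · exact hu k' h
      · exfalso
        have h3 := (hreg _ _ (by omega) hi₁ h).1
        apply hbo
        have h4 := base_cases s L 0 b
        have h5 : base s L 0 = s - 3 + L := by simp [base]
        omega

lemma SpecDec.served_of_disjoint {m s i k : ℕ} {S : Fin 3 → ℕ → Prop}
    (hS : ∀ t t' j, S t j → S t' j → t = t') (h : SpecDec m s S i k) : Served m s S i k := by
  obtain ⟨hk, a, hak, ha⟩ := h
  have hc : ∀ t j, S t j → comb S a j = a t := by
    intro t j hj
    rw [comb, Finset.sum_eq_single t]
    · simp [hj]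
    · intro t' _ ht'
      rw [if_neg fun h => ht' (hS _ _ _ h hj), mul_zero]
    · simp
  obtain ⟨t, ht⟩ : ∃ t, S t k := by
    by_contra! h
    exact hak (by simp [comb, h])
  refine ⟨hk, t, ht, fun j hj hjk => ?_⟩
  by_contra hjn
  apply hak
  rw [hc t k ht, ← hc t j hj]
  exact ha j hjn hjk

/-- Exceptional rows for a block of length `2 * s - d` with `2 ≤ d ≤ s - 3`. -/
def shortRows (s d : ℕ) : Fin 3 → ℕ → Prop :=
  ![fun j => j + d = s - 3 ∨ j + d = s - 3 + 2 ∨ j = s - 3 ∨ j = s - 3 + 1,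
    fun j => j = s - 3 + 2 ∨ j + d = s - 3 + s,
    fun j => j + d = s - 3 + (s + 1) ∨ j + d = s - 3 + (s + 2) ∨ j = s - 3 + (s + 2)]

lemma exists_served_iff {m s i k : ℕ} {S : Fin 3 → ℕ → Prop} :
    Served m s S i k ↔ ¬ Known m s i k ∧ ((S 0 k ∧ ∀ j, S 0 j → j ≠ k → Known m s i j) ∨
      (S 1 k ∧ ∀ j, S 1 j → j ≠ k → Known m s i j) ∨
      (S 2 k ∧ ∀ j, S 2 j → j ≠ k → Known m s i j)) := by
  simp [Served, Fin.exists_fin_succ]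

lemma known_iff_of_lt {m s L o j : ℕ} (hs : 5 ≤ s) (hm : 2 * s + L ≤ m) (hj : j < s - 3 + L) :
    Known m s (s - 3 + o) j ↔ (j ≤ s - 3 + o ∧ o < j + 3) ∨ j + m ≤ s - 3 + o := by
  unfold Known
  omega

lemma served_shortRows {m s d L o k : ℕ} (hd : 2 ≤ d) (hd' : d ≤ s - 3) (hs : 5 ≤ s)
    (hL : L + d = 2 * s) (hm : 2 * s + L ≤ m) (ho : o < m)
    (h : Served m s (shortRows s d) (s - 3 + o) k) :
    (o = 0 ∧ k = s - 3 + 1) ∨ (2 ≤ o ∧ o < s - d ∧ k + d = s - 3 + s) ∨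
    (s - d ≤ o ∧ o < s - d + 2 ∧ k + d = s - 3) ∨
    (s - d + 2 ≤ o ∧ o < s + 2 ∧ k = s - 3 + (s + 2)) ∨
    (s + 2 ≤ o ∧ o < L ∧ k = s - 3 + 2) ∨ (o = L + 1 ∧ k + d = s - 3 + (s + 1)) := by
  obtain ⟨e, rfl⟩ : ∃ e, s = e + d + 3 := ⟨s - 3 - d, by omega⟩
  obtain rfl : L = 2 * e + d + 6 := by omega
  rw [exists_served_iff] at h
  simp only [shortRows, Matrix.cons_val] at h
  obtain ⟨hk, h⟩ := h
  rw [known_iff_of_lt hs hm (by omega)] at hk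
  have key : ∀ j, Known m (e + d + 3) (e + d + 3 - 3 + o) j → j < 3 * e + 2 * d + 6 →
    (j ≤ e + d + o ∧ o < j + 3) ∨ j + m ≤ e + d + o :=
    fun j h hj => (known_iff_of_lt hs hm (by omega)).1 h
  simp only [Nat.add_sub_cancel] at *
  have hsub : e + d + 3 - d = e + 3 := by omega
  rw [hsub]
  clear hd' hs hL hsub
  obtain ⟨h, h'⟩ | ⟨h, h'⟩ | ⟨h, h'⟩ := h
  · rcases h with h | h | h | h
    · have e1 := key _ (h' (e + d + 1) (by omega) (by omega)) (by omega)
      have e2 := key _ (h' (e + 2) (by omega) (by omega)) (by omega)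
      right; right; left; omega
    · have e1 := key _ (h' (e + d + 1) (by omega) (by omega)) (by omega)
      have e2 := key _ (h' e (by omega) (by omega)) (by omega)
      omega
    · have e1 := key _ (h' (e + d + 1) (by omega) (by omega)) (by omega)
      have e2 := key _ (h' e (by omega) (by omega)) (by omega)
      omega
    · have e1 := key _ (h' (e + d) (by omega) (by omega)) (by omega)
      left; omega
  · rcases h with h | h
    · have e1 := key _ (h' (e + e + d + 3) (by omega) (by omega)) (by omega)
      right; right; right; right; left; omega
    · have e1 := key _ (h' (e + d + 2) (by omega) (by omega)) (by omega)
      right; left; omega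
  · rcases h with h | h | h
    · have e1 := key _ (h' (2 * e + 2 * d + 5) (by omega) (by omega)) (by omega)
      have e2 := key _ (h' (2 * e + d + 5) (by omega) (by omega)) (by omega)
      right; right; right; right; right; omega
    · have e1 := key _ (h' (2 * e + 2 * d + 5) (by omega) (by omega)) (by omega)
      have e2 := key _ (h' (2 * e + d + 4) (by omega) (by omega)) (by omega)
      omega
    · have e2 := key _ (h' (2 * e + d + 4) (by omega) (by omega)) (by omega)
      have e1 := key _ (h' (2 * e + d + 5) (by omega) (by omega)) (by omega)
      right; right; right; left; omega

lemma exists_served_shortRows {m s d L o k : ℕ} (hd : 2 ≤ d) (hd' : d ≤ s - 3) (hs : 5 ≤ s)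
    (hL : L + d = 2 * s) (hm : 2 * s + L ≤ m)
    (h : (o = 0 ∧ k = s - 3 + 1) ∨ (2 ≤ o ∧ o < s - d ∧ k + d = s - 3 + s) ∨
      (s - d ≤ o ∧ o < s - d + 2 ∧ k + d = s - 3) ∨
      (s - d + 2 ≤ o ∧ o < s + 2 ∧ k = s - 3 + (s + 2)) ∨
      (s + 2 ≤ o ∧ o < L ∧ k = s - 3 + 2) ∨ (o = L + 1 ∧ k + d = s - 3 + (s + 1))) :
    Served m s (shortRows s d) (s - 3 + o) k := by
  obtain ⟨e, rfl⟩ : ∃ e, s = e + d + 3 := ⟨s - 3 - d, by omega⟩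
  obtain rfl : L = 2 * e + d + 6 := by omega
  have hsub : e + d + 3 - d = e + 3 := by omega
  rw [exists_served_iff]
  simp only [shortRows, Matrix.cons_val, Nat.add_sub_cancel, hsub] at *
  have hk : k < 3 * e + 2 * d + 6 := by omega
  refine ⟨fun hn => ?_, ?_⟩
  · unfold Known at hn
    omega
  rcases h with h | h | h | h | h | h
  · refine Or.inl ⟨by omega, fun j hj hjk => Or.inl ?_⟩
    omega
  · refine Or.inr (Or.inl ⟨by omega, fun j hj hjk => Or.inl ?_⟩)
    omega
  · refine Or.inl ⟨by omega, fun j hj hjk => Or.inl ?_⟩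
    omega
  · refine Or.inr (Or.inr ⟨by omega, fun j hj hjk => Or.inl ?_⟩)
    omega
  · refine Or.inr (Or.inl ⟨by omega, fun j hj hjk => Or.inl ?_⟩)
    omega
  · refine Or.inr (Or.inr ⟨by omega, fun j hj hjk => Or.inl ?_⟩)
    omega

lemma shortRows_disjoint {s d : ℕ} (hd : 2 ≤ d) (hd' : d ≤ s - 3) (hs : 5 ≤ s)
    (t t' : Fin 3) (j : ℕ) (h : shortRows s d t j) (h' : shortRows s d t' j) : t = t' := by
  fin_cases t <;> fin_cases t' <;> simp [shortRows] at h h' ⊢ <;> omega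

theorem exists_code_short {m s d q ℓ : ℕ} (hs : 5 ≤ s) (hd : 2 ≤ d) (hd' : d ≤ s - 3)
    (hq : 0 < q) (hm : m + d = 2 * s * q + 2 * s) (hℓ : 3 * q + 3 = ℓ) :
    ∃ G : Fin ℓ → ZMod m → ZMod 2, IsDecentralizedCode m s G ∧ Correct m s G ∧ Secure m s G := by
  have hm' : 2 * s ≤ 2 * s * q := Nat.le_mul_of_pos_right _ hq
  have hL : 2 * s - d + d = 2 * s := by omega
  have hmL : 2 * s + (2 * s - d) ≤ m := by omega
  have dec : ∀ o k, o < m → SpecDec m s (shortRows s d) (s - 3 + o) k → _ := fun o k ho h =>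
    served_shortRows hd hd' hs hL hmL ho (h.served_of_disjoint (shortRows_disjoint hd hd' hs))
  refine exists_code_of_exceptional_rows (L := 2 * s - d) hs hq (by omega) (by omega) hℓ
    (shortRows s d) (s - 3 + (s + 1) - d) ?_ ?_ ?_ ?_ ?_
  · intro t
    fin_cases t
    · refine ⟨s - 3 + 1, by omega, fun j hj => ?_⟩
      simp [shortRows] at hj
      omega
    · refine ⟨s - 3 + s - d, by omega, fun j hj => ?_⟩
      simp [shortRows] at hj
      omega
    · refine ⟨s - 3 + (s + 2), by omega, fun j hj => ?_⟩
      simp [shortRows] at hj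
      omega
  · rw [add_assoc]
    exact exists_served_shortRows hd hd' hs hL hmL (by omega)
  · intro o ho ho1
    have : ∃ k, (o = 0 ∧ k = s - 3 + 1) ∨ (2 ≤ o ∧ o < s - d ∧ k + d = s - 3 + s) ∨
      (s - d ≤ o ∧ o < s - d + 2 ∧ k + d = s - 3) ∨
      (s - d + 2 ≤ o ∧ o < s + 2 ∧ k = s - 3 + (s + 2)) ∨
      (s + 2 ≤ o ∧ o < 2 * s - d ∧ k = s - 3 + 2) ∨
      (o = 2 * s - d + 1 ∧ k + d = s - 3 + (s + 1)) := by
      by_cases h1 : o = 0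
      · exact ⟨s - 3 + 1, by omega⟩
      by_cases h2 : o < s - d
      · exact ⟨s - 3 + s - d, by omega⟩
      by_cases h3 : o < s - d + 2
      · exact ⟨s - 3 - d, by omega⟩
      by_cases h4 : o < s + 2
      · exact ⟨s - 3 + (s + 2), by omega⟩
      · exact ⟨s - 3 + 2, by omega⟩
    obtain ⟨k, hk⟩ := this
    refine ⟨k, exists_served_shortRows hd hd' hs hL hmL hk, fun k' h => ?_⟩
    have := dec o k' (by omega) h
    clear h
    omega
  · intro k h
    have := dec 1 k (by omega) h
    omega
  · intro i k hi hi' h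
    obtain ⟨o, rfl⟩ : ∃ o, i = s - 3 + o := ⟨i - (s - 3), by omega⟩
    have := dec o k (by omega) h
    omega

lemma comb_ne_zero_iff {S : Fin 3 → ℕ → Prop} {a : Fin 3 → ZMod 2} {j : ℕ} :
    comb S a j ≠ 0 ↔
      ((a 0 = 1 ∧ S 0 j) ↔ ((a 1 = 1 ∧ S 1 j) ↔ (a 2 = 1 ∧ S 2 j))) := by
  have H : ∀ x : ZMod 2, x = 0 ∨ x = 1 := by decide
  simp only [comb, Fin.sum_univ_three]
  by_cases h0 : S 0 j <;> by_cases h1 : S 1 j <;> by_cases h2 : S 2 j <;>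
  rcases H (a 0) with e0 | e0 <;> rcases H (a 1) with e1 | e1 <;> rcases H (a 2) with e2 | e2 <;>
  simp [h0, h1, h2, e0, e1, e2] <;> decide

lemma SpecDec.exists_combination {m s i k : ℕ} {S : Fin 3 → ℕ → Prop} (h : SpecDec m s S i k) :
    ∃ A B C : Prop, ((A ∧ S 0 k) ↔ ((B ∧ S 1 k) ↔ (C ∧ S 2 k))) ∧
      ∀ j, ((A ∧ S 0 j) ↔ ((B ∧ S 1 j) ↔ (C ∧ S 2 j))) → j ≠ k → Known m s i j := by
  obtain ⟨-, a, hak, ha⟩ := h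
  refine ⟨a 0 = 1, a 1 = 1, a 2 = 1, comb_ne_zero_iff.1 hak, fun j hj hjk => ?_⟩
  by_contra hn
  exact comb_ne_zero_iff.2 hj (ha j hn hjk)

/-- Exceptional rows for a block of length `s + 2`. -/
def twoRows (s : ℕ) : Fin 3 → ℕ → Prop :=
  ![fun j => j = 0 ∨ j = 1 ∨ j = s - 3 ∨ j = s - 3 + 1,
    fun j => j = s - 3 + 1 ∨ j = s - 3 + 2 ∨ j = s - 3 + 3,
    fun j => j = s - 3 + 3 ∨ j = s - 3 + 4 ∨ j = s - 3 + (s + 1)]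

set_option maxHeartbeats 1000000 in
lemma specDec_twoRows {m s o k : ℕ} (hs : 5 ≤ s) (hm : 2 * s + (s + 2) ≤ m) (ho : o < m)
    (h : SpecDec m s (twoRows s) (s - 3 + o) k) :
    (o = 0 ∧ k = s - 3 + 1) ∨ (o = 2 ∧ k = s - 3 + 3) ∨ (o = 3 ∧ k = 0) ∨
    (4 ≤ o ∧ o < s + 1 ∧ k = s - 3 + (s + 1)) ∨ (o = s + 1 ∧ k = s - 3 + 1) ∨
    (o = s + 3 ∧ k = s - 3 + 3) := by
  obtain ⟨c, rfl⟩ : ∃ c, s = c + 3 := ⟨s - 3, by omega⟩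
  have hk := h.1
  obtain ⟨A, B, C, h, h'⟩ := h.exists_combination
  simp only [twoRows, Matrix.cons_val, Nat.add_sub_cancel] at *
  have hk2 : k = 0 ∨ k = 1 ∨ k = c ∨ k = c + 1 ∨ k = c + 2 ∨ k = c + 3 ∨ k = c + 4 ∨
      k = 2 * c + 4 := by
    omega
  have known : ∀ j, j < 2 * c + 5 → (Known m (c + 3) (c + o) j ↔
      (j ≤ c + o ∧ o < j + 3) ∨ j + m ≤ c + o) :=
    fun j hj => known_iff_of_lt hs hm (by omega)
  have known' : ∀ j, c ≤ j → j < 2 * c + 5 → (Known m (c + 3) (c + o) j ↔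
      (j ≤ c + o ∧ o < j + 3)) := fun j hj hj' => by
    rw [known j hj']
    omega
  have e0 : ∀ j ≠ k, j = 0 → A → (o < 3 ∨ m ≤ c + o) := fun j hj hj' hA => by
    have := (known j (by omega)).1 (h' j (by subst hj'; grind) hj)
    omega
  have e1 : ∀ j ≠ k, j = 1 → A → (o < 4 ∨ 1 + m ≤ c + o) := fun j hj hj' hA => by
    have := (known j (by omega)).1 (h' j (by subst hj'; grind) hj)
    omega
  have e2 : ∀ j ≠ k, j = c → A → o < c + 3 := fun j hj hj' hA => by
    have := (known' j (by omega) (by omega)).1 (h' j (by subst hj'; grind) hj)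
    omega
  have e3 : ∀ j ≠ k, j = c + 1 → (A ↔ ¬ B) → 1 ≤ o ∧ o < c + 4 := fun j hj hj' hA => by
    have := (known' j (by omega) (by omega)).1 (h' j (by subst hj'; grind) hj)
    omega
  have e4 : ∀ j ≠ k, j = c + 2 → B → 2 ≤ o ∧ o < c + 5 := fun j hj hj' hA => by
    have := (known' j (by omega) (by omega)).1 (h' j (by subst hj'; grind) hj)
    omega
  have e5 : ∀ j ≠ k, j = c + 3 → (B ↔ ¬ C) → 3 ≤ o ∧ o < c + 6 := fun j hj hj' hA => by
    have := (known' j (by omega) (by omega)).1 (h' j (by subst hj'; grind) hj)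
    omega
  have e6 : ∀ j ≠ k, j = c + 4 → C → 4 ≤ o ∧ o < c + 7 := fun j hj hj' hA => by
    have := (known' j (by omega) (by omega)).1 (h' j (by subst hj'; grind) hj)
    omega
  have e7 : ∀ j ≠ k, j = 2 * c + 4 → C → c + 4 ≤ o ∧ o < 2 * c + 7 := fun j hj hj' hA => by
    have := (known' j (by omega) (by omega)).1 (h' j (by subst hj'; grind) hj)
    omega
  rw [known k (by omega)] at hk
  clear h' known known'
  rcases hk2 with rfl | rfl | rfl | rfl | rfl | rfl | rfl | rfl
  · have hA : A := by grind
    have := e1 _ (by omega) rfl hA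
    have := e2 _ (by omega) rfl hA
    omega
  · have hA : A := by grind
    have := e0 _ (by omega) rfl hA
    have := e2 _ (by omega) rfl hA
    omega
  · have hA : A := by grind
    have := e0 _ (by omega) rfl hA
    have := e1 _ (by omega) rfl hA
    by_cases hB : B
    · have := e4 _ (by omega) rfl hB
      omega
    · have := e3 _ (by omega) rfl (iff_of_true hA hB)
      omega
  · have hAB : A ↔ ¬ B := by grind
    by_cases hA : A
    · have := e2 _ (by omega) rfl hA
      omega
    · have := e4 _ (by omega) rfl (by simpa [hA] using hAB)
      omega
  · have hB : B := by grind
    by_cases hC : C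
    · have := e6 _ (by omega) rfl hC
      by_cases hA : A
      · have := e2 _ (by omega) rfl hA
        omega
      · have := e3 _ (by omega) rfl (iff_of_false hA (not_not.2 hB))
        omega
    · have := e5 _ (by omega) rfl (iff_of_true hB hC)
      by_cases hA : A
      · have := e2 _ (by omega) rfl hA
        omega
      · have := e3 _ (by omega) rfl (iff_of_false hA (not_not.2 hB))
        omega
  · have hBC : B ↔ ¬ C := by grind
    by_cases hB : B
    · have := e4 _ (by omega) rfl hB
      omega
    · have := e6 _ (by omega) rfl (by simpa [hB] using hBC)
      omega
  · have hC : C := by grind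
    have := e7 _ (by omega) rfl hC
    by_cases hB : B
    · have := e4 _ (by omega) rfl hB
      omega
    · have := e5 _ (by omega) rfl (iff_of_false hB (not_not.2 hC))
      omega
  · have hC : C := by grind
    have := e6 _ (by omega) rfl hC
    omega

lemma exists_served_twoRows {m s o k : ℕ} (hs : 5 ≤ s) (hm : 2 * s + (s + 2) ≤ m)
    (h : (o = 0 ∧ k = s - 3 + 1) ∨ (o = 2 ∧ k = s - 3 + 3) ∨ (o = 3 ∧ k = 0) ∨
      (4 ≤ o ∧ o < s + 1 ∧ k = s - 3 + (s + 1)) ∨ (o = s + 1 ∧ k = s - 3 + 1) ∨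
      (o = s + 3 ∧ k = s - 3 + 3)) :
    Served m s (twoRows s) (s - 3 + o) k := by
  obtain ⟨c, rfl⟩ : ∃ c, s = c + 3 := ⟨s - 3, by omega⟩
  rw [exists_served_iff]
  simp only [twoRows, Matrix.cons_val, Nat.add_sub_cancel] at *
  refine ⟨fun hn => ?_, ?_⟩
  · unfold Known at hn
    omega
  rcases h with ⟨rfl, rfl⟩ | ⟨rfl, rfl⟩ | ⟨rfl, rfl⟩ | ⟨h4, h5, rfl⟩ | ⟨rfl, rfl⟩ | ⟨rfl, rfl⟩
  · refine Or.inl ⟨by omega, fun j hj hjk => Or.inl ?_⟩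
    omega
  · refine Or.inr (Or.inl ⟨by omega, fun j hj hjk => Or.inl ?_⟩)
    omega
  · refine Or.inl ⟨by omega, fun j hj hjk => Or.inl ?_⟩
    omega
  · refine Or.inr (Or.inr ⟨by omega, fun j hj hjk => Or.inl ?_⟩)
    omega
  · refine Or.inr (Or.inl ⟨by omega, fun j hj hjk => Or.inl ?_⟩)
    omega
  · refine Or.inr (Or.inr ⟨by omega, fun j hj hjk => Or.inl ?_⟩)
    omega

theorem exists_code_two {m s q ℓ : ℕ} (hs : 5 ≤ s) (hq : 0 < q)
    (hm : m = 2 * s * q + (s + 2)) (hℓ : 3 * q + 3 = ℓ) :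
    ∃ G : Fin ℓ → ZMod m → ZMod 2, IsDecentralizedCode m s G ∧ Correct m s G ∧ Secure m s G := by
  have hmL : 2 * s + (s + 2) ≤ m := by
    have : 2 * s ≤ 2 * s * q := Nat.le_mul_of_pos_right _ hq
    omega
  refine exists_code_of_exceptional_rows hs hq (by omega) hm hℓ (twoRows s) (s - 3 + 3)
    ?_ ?_ ?_ ?_ ?_
  · intro t
    fin_cases t
    · refine ⟨s - 3 + 1, by omega, fun j hj => ?_⟩
      simp [twoRows] at hj
      omega
    · refine ⟨s - 3 + 3, by omega, fun j hj => ?_⟩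
      simp [twoRows] at hj
      omega
    · refine ⟨s - 3 + (s + 1), by omega, fun j hj => ?_⟩
      simp [twoRows] at hj
      omega
  · rw [add_assoc]
    exact exists_served_twoRows hs hmL (by omega)
  · intro o ho ho1
    have : ∃ k, (o = 0 ∧ k = s - 3 + 1) ∨ (o = 2 ∧ k = s - 3 + 3) ∨ (o = 3 ∧ k = 0) ∨
      (4 ≤ o ∧ o < s + 1 ∧ k = s - 3 + (s + 1)) ∨ (o = s + 1 ∧ k = s - 3 + 1) ∨
      (o = s + 3 ∧ k = s - 3 + 3) := by
      by_cases h1 : o = 0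
      · exact ⟨s - 3 + 1, by omega⟩
      by_cases h2 : o = 2
      · exact ⟨s - 3 + 3, by omega⟩
      by_cases h3 : o = 3
      · exact ⟨0, by omega⟩
      by_cases h4 : o < s + 1
      · exact ⟨s - 3 + (s + 1), by omega⟩
      · exact ⟨s - 3 + 1, by omega⟩
    obtain ⟨k, hk⟩ := this
    refine ⟨k, exists_served_twoRows hs hmL hk, fun k' h => ?_⟩
    have := specDec_twoRows hs hmL (by omega) h
    clear h
    omega
  · intro k h
    have := specDec_twoRows hs hmL (by omega) h
    omega
  · intro i k hi hi' h
    obtain ⟨o, rfl⟩ : ∃ o, i = s - 3 + o := ⟨i - (s - 3), by omega⟩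
    have := specDec_twoRows hs hmL (by omega) h
    omega

/-- Exceptional rows for a block of length `s + 1`. -/
def oneRows (s : ℕ) : Fin 3 → ℕ → Prop :=
  ![fun j => j = 0 ∨ j = 1 ∨ j = s - 3 ∨ j = s - 3 + 1,
    fun j => j = s - 3 ∨ j = s - 3 + 1 ∨ j = s - 3 + 2 ∨ j = s - 3 + 3,
    fun j => j = s - 3 + 2 ∨ j = s - 3 + 3 ∨ j = s - 3 + 4 ∨ j = s - 3 + s]

set_option maxHeartbeats 1000000 in
lemma specDec_oneRows {m s o k : ℕ} (hs : 5 ≤ s) (hm : 2 * s + (s + 1) ≤ m) (ho : o < m)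
    (h : SpecDec m s (oneRows s) (s - 3 + o) k) :
    (o = 0 ∧ k = s - 3 + 1) ∨ (o = 2 ∧ k = s - 3 + 3) ∨ (o = 3 ∧ k = 0) ∨
    (4 ≤ o ∧ o < s ∧ k = s - 3 + s) ∨ (o = s ∧ k = s - 3) ∨
    (o = s + 2 ∧ k = s - 3 + 2) := by
  obtain ⟨c, rfl⟩ : ∃ c, s = c + 3 := ⟨s - 3, by omega⟩
  have hk := h.1
  obtain ⟨A, B, C, h, h'⟩ := h.exists_combination
  simp only [oneRows, Matrix.cons_val, Nat.add_sub_cancel] at *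
  have hk2 : k = 0 ∨ k = 1 ∨ k = c ∨ k = c + 1 ∨ k = c + 2 ∨ k = c + 3 ∨ k = c + 4 ∨
      k = 2 * c + 3 := by
    omega
  have known : ∀ j, j < 2 * c + 4 → (Known m (c + 3) (c + o) j ↔
      (j ≤ c + o ∧ o < j + 3) ∨ j + m ≤ c + o) :=
    fun j hj => known_iff_of_lt hs hm (by omega)
  have known' : ∀ j, c ≤ j → j < 2 * c + 4 → (Known m (c + 3) (c + o) j ↔
      (j ≤ c + o ∧ o < j + 3)) := fun j hj hj' => by
    rw [known j hj']
    omega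
  have e0 : ∀ j ≠ k, j = 0 → A → (o < 3 ∨ m ≤ c + o) := fun j hj hj' hA => by
    have := (known j (by omega)).1 (h' j (by subst hj'; grind) hj)
    omega
  have e1 : ∀ j ≠ k, j = 1 → A → (o < 4 ∨ 1 + m ≤ c + o) := fun j hj hj' hA => by
    have := (known j (by omega)).1 (h' j (by subst hj'; grind) hj)
    omega
  have e2 : ∀ j ≠ k, j = c → (A ↔ ¬ B) → o < c + 3 := fun j hj hj' hA => by
    have := (known' j (by omega) (by omega)).1 (h' j (by subst hj'; grind) hj)
    omega
  have e3 : ∀ j ≠ k, j = c + 1 → (A ↔ ¬ B) → 1 ≤ o ∧ o < c + 4 := fun j hj hj' hA => by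
    have := (known' j (by omega) (by omega)).1 (h' j (by subst hj'; grind) hj)
    omega
  have e4 : ∀ j ≠ k, j = c + 2 → (B ↔ ¬ C) → 2 ≤ o ∧ o < c + 5 := fun j hj hj' hA => by
    have := (known' j (by omega) (by omega)).1 (h' j (by subst hj'; grind) hj)
    omega
  have e5 : ∀ j ≠ k, j = c + 3 → (B ↔ ¬ C) → 3 ≤ o ∧ o < c + 6 := fun j hj hj' hA => by
    have := (known' j (by omega) (by omega)).1 (h' j (by subst hj'; grind) hj)
    omega
  have e6 : ∀ j ≠ k, j = c + 4 → C → 4 ≤ o ∧ o < c + 7 := fun j hj hj' hA => by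
    have := (known' j (by omega) (by omega)).1 (h' j (by subst hj'; grind) hj)
    omega
  have e7 : ∀ j ≠ k, j = 2 * c + 3 → C → c + 3 ≤ o ∧ o < 2 * c + 6 := fun j hj hj' hA => by
    have := (known' j (by omega) (by omega)).1 (h' j (by subst hj'; grind) hj)
    omega
  rw [known k (by omega)] at hk
  clear h' known known'
  rcases hk2 with rfl | rfl | rfl | rfl | rfl | rfl | rfl | rfl
  · have hA : A := by grind
    have := e1 _ (by omega) rfl hA
    omega
  · have hA : A := by grind
    have := e0 _ (by omega) rfl hA
    by_cases hB : B
    · by_cases hC : C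
      · have := e6 _ (by omega) rfl hC
        omega
      · have := e4 _ (by omega) rfl (iff_of_true hB hC)
        omega
    · have := e2 _ (by omega) rfl (iff_of_true hA hB)
      omega
  · have hAB : A ↔ ¬ B := by grind
    have := e3 _ (by omega) rfl hAB
    by_cases hA : A
    · have := e0 _ (by omega) rfl hA
      omega
    · omega
  · have hAB : A ↔ ¬ B := by grind
    have := e2 _ (by omega) rfl hAB
    omega
  · have hBC : B ↔ ¬ C := by grind
    have := e5 _ (by omega) rfl hBC
    omega
  · have hBC : B ↔ ¬ C := by grind
    have := e4 _ (by omega) rfl hBC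
    omega
  · have hC : C := by grind
    have := e7 _ (by omega) rfl hC
    by_cases hB : B
    · by_cases hA : A
      · have := e0 _ (by omega) rfl hA
        omega
      · have := e2 _ (by omega) rfl (iff_of_false hA (not_not.2 hB))
        omega
    · have := e4 _ (by omega) rfl (iff_of_false hB (not_not.2 hC))
      omega
  · have hC : C := by grind
    have := e6 _ (by omega) rfl hC
    omega

lemma exists_served_oneRows {m s o k : ℕ} (hs : 5 ≤ s) (hm : 2 * s + (s + 1) ≤ m)
    (h : (o = 0 ∧ k = s - 3 + 1) ∨ (o = 2 ∧ k = s - 3 + 3) ∨ (o = 3 ∧ k = 0) ∨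
      (4 ≤ o ∧ o < s ∧ k = s - 3 + s) ∨ (o = s ∧ k = s - 3) ∨
      (o = s + 2 ∧ k = s - 3 + 2)) :
    Served m s (oneRows s) (s - 3 + o) k := by
  obtain ⟨c, rfl⟩ : ∃ c, s = c + 3 := ⟨s - 3, by omega⟩
  rw [exists_served_iff]
  simp only [oneRows, Matrix.cons_val, Nat.add_sub_cancel] at *
  refine ⟨fun hn => ?_, ?_⟩
  · unfold Known at hn
    omega
  rcases h with ⟨rfl, rfl⟩ | ⟨rfl, rfl⟩ | ⟨rfl, rfl⟩ | ⟨h4, h5, rfl⟩ | ⟨rfl, rfl⟩ | ⟨rfl, rfl⟩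
  · refine Or.inl ⟨by omega, fun j hj hjk => Or.inl ?_⟩
    omega
  · refine Or.inr (Or.inl ⟨by omega, fun j hj hjk => Or.inl ?_⟩)
    omega
  · refine Or.inl ⟨by omega, fun j hj hjk => Or.inl ?_⟩
    omega
  · refine Or.inr (Or.inr ⟨by omega, fun j hj hjk => Or.inl ?_⟩)
    omega
  · refine Or.inr (Or.inl ⟨by omega, fun j hj hjk => Or.inl ?_⟩)
    omega
  · refine Or.inr (Or.inr ⟨by omega, fun j hj hjk => Or.inl ?_⟩)
    omega

theorem exists_code_one {m s q ℓ : ℕ} (hs : 5 ≤ s) (hq : 0 < q)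
    (hm : m = 2 * s * q + (s + 1)) (hℓ : 3 * q + 3 = ℓ) :
    ∃ G : Fin ℓ → ZMod m → ZMod 2, IsDecentralizedCode m s G ∧ Correct m s G ∧ Secure m s G := by
  have hmL : 2 * s + (s + 1) ≤ m := by
    have : 2 * s ≤ 2 * s * q := Nat.le_mul_of_pos_right _ hq
    omega
  refine exists_code_of_exceptional_rows hs hq (by omega) hm hℓ (oneRows s) (s - 3 + 2)
    ?_ ?_ ?_ ?_ ?_
  · intro t
    fin_cases t
    · refine ⟨s - 3 + 1, by omega, fun j hj => ?_⟩
      simp [oneRows] at hj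
      omega
    · refine ⟨s - 3 + 3, by omega, fun j hj => ?_⟩
      simp [oneRows] at hj
      omega
    · refine ⟨s - 3 + s, by omega, fun j hj => ?_⟩
      simp [oneRows] at hj
      omega
  · rw [add_assoc]
    exact exists_served_oneRows hs hmL (by omega)
  · intro o ho ho1
    have : ∃ k, (o = 0 ∧ k = s - 3 + 1) ∨ (o = 2 ∧ k = s - 3 + 3) ∨ (o = 3 ∧ k = 0) ∨
      (4 ≤ o ∧ o < s ∧ k = s - 3 + s) ∨ (o = s ∧ k = s - 3) ∨
      (o = s + 2 ∧ k = s - 3 + 2) := by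
      by_cases h1 : o = 0
      · exact ⟨s - 3 + 1, by omega⟩
      by_cases h2 : o = 2
      · exact ⟨s - 3 + 3, by omega⟩
      by_cases h3 : o = 3
      · exact ⟨0, by omega⟩
      by_cases h4 : o < s
      · exact ⟨s - 3 + s, by omega⟩
      · exact ⟨s - 3, by omega⟩
    obtain ⟨k, hk⟩ := this
    refine ⟨k, exists_served_oneRows hs hmL hk, fun k' h => ?_⟩
    have := specDec_oneRows hs hmL (by omega) h
    clear h
    omega
  · intro k h
    have := specDec_oneRows hs hmL (by omega) h
    omega
  · intro i k hi hi' h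
    obtain ⟨o, rfl⟩ : ∃ o, i = s - 3 + o := ⟨i - (s - 3), by omega⟩
    have := specDec_oneRows hs hmL (by omega) h
    omega

end SDPicod

theorem feasible_mod_s_add_one_to_two_s_sub_two (m s : ℕ) (hs : 5 ≤ s)
    (hm : 2 * s < m)
    (hlo : s + 1 ≤ m % (2 * s)) (hhi : m % (2 * s) ≤ 2 * s - 2) :
    ∃ G : Fin (3 * (m - m % (2 * s)) / (2 * s) + 3) → ZMod m → ZMod 2,
      IsDecentralizedCode m s G ∧ Correct m s G ∧ Secure m s G := by
  have hdiv := Nat.div_add_mod m (2 * s)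
  have hq : 0 < m / (2 * s) := Nat.div_pos hm.le (by omega)
  generalize hr : m % (2 * s) = r at *
  generalize m / (2 * s) = q at *
  have hℓ : 3 * q + 3 = 3 * (m - r) / (2 * s) + 3 := by
    rw [← hdiv, Nat.add_sub_cancel, mul_left_comm, Nat.mul_div_cancel_left _ (by omega)]
  by_cases h1 : r = s + 1
  · exact exists_code_one hs hq (by omega) hℓ
  by_cases h2 : r = s + 2
  · exact exists_code_two hs hq (by omega) hℓ
  · exact exists_code_short (d := 2 * s - r) hs (by omega) (by omega) hq (by omega) hℓ
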